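/- Let d ≥ 1, δ ∈ (0,1) and α ∈ (0, 1/2]. For all u₁, u₂, v₁, v₂ ∈ ℝ^d, |(u₁^{(δ)} − u₂^{(δ)}) − (v₁ − v₂)| ≤ |u₁ − v₁| + |u₂ − v₂| + δ^α (|u₁|² + |u₂|²), where w^{(δ)} = w/(1 + δ^α |w|) for w ∈ ℝ^d. -/

import Mathlib

/-- Taming a vector `w` by the factor `(1 + c * ‖w‖)⁻¹` moves it by at most `c * ‖w‖ ^ 2`. -/
theorem norm_taming_sub_self_le {E : Type*} [SeminormedAddCommGroup E] [NormedSpace ℝ E]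
    {c : ℝ} (hc : 0 ≤ c) (w : E) :
    ‖(1 + c * ‖w‖)⁻¹ • w - w‖ ≤ c * ‖w‖ ^ 2 := by
  have hcw : 0 ≤ c * ‖w‖ := by positivity
  have hpos : 0 < 1 + c * ‖w‖ := by positivity
  have hle : (1 + c * ‖w‖)⁻¹ ≤ 1 := inv_le_one_of_one_le₀ (by linarith)
  have hge : 1 - c * ‖w‖ ≤ (1 + c * ‖w‖)⁻¹ := by
    rw [← one_div, le_div_iff₀ hpos]
    nlinarith [sq_nonneg (c * ‖w‖)]
  calc ‖(1 + c * ‖w‖)⁻¹ • w - w‖ = ‖((1 + c * ‖w‖)⁻¹ - 1) • w‖ := by rw [sub_smul, one_smul]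
    _ = (1 - (1 + c * ‖w‖)⁻¹) * ‖w‖ := by
      rw [norm_smul, Real.norm_of_nonpos (by linarith), neg_sub]
    _ ≤ (c * ‖w‖) * ‖w‖ := by gcongr; linarith
    _ = c * ‖w‖ ^ 2 := by ring

/-- Vector-level core of estimate (t1) in the proof of Lemma 2.4 of the paper, with
`w^{(δ)} = w/(1 + δ^α |w|)`. -/
theorem stmt_4 (d : ℕ) (hd : 1 ≤ d) (δ α : ℝ) (hδ : δ ∈ Set.Ioo (0 : ℝ) 1)
    (hα : α ∈ Set.Ioc (0 : ℝ) (1 / 2)) (u₁ u₂ v₁ v₂ : EuclideanSpace ℝ (Fin d)) :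
    ‖((1 + δ ^ α * ‖u₁‖)⁻¹ • u₁ - (1 + δ ^ α * ‖u₂‖)⁻¹ • u₂) - (v₁ - v₂)‖
      ≤ ‖u₁ - v₁‖ + ‖u₂ - v₂‖ + δ ^ α * (‖u₁‖ ^ 2 + ‖u₂‖ ^ 2) := by
  have hc : 0 ≤ δ ^ α := Real.rpow_nonneg hδ.1.le α
  have h (u v : EuclideanSpace ℝ (Fin d)) :
      ‖(1 + δ ^ α * ‖u‖)⁻¹ • u - v‖ ≤ δ ^ α * ‖u‖ ^ 2 + ‖u - v‖ :=
    (norm_sub_le_norm_sub_add_norm_sub _ u v).trans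
      (add_le_add_left (norm_taming_sub_self_le hc u) _)
  rw [sub_sub_sub_comm]
  linarith [norm_sub_le ((1 + δ ^ α * ‖u₁‖)⁻¹ • u₁ - v₁) ((1 + δ ^ α * ‖u₂‖)⁻¹ • u₂ - v₂),
    h u₁ v₁, h u₂ v₂]
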